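/- Let p be a prime, let a ≥ 1 and m ≥ 0 be integers with gcd(a, p) = 1, and let ā denote the image of a in 𝔽_p. Let T : 𝔽_{p^p}[X] → 𝔽_p[X] denote the coefficientwise (𝔽_p[X]-linear) extension of the trace Tr : 𝔽_{p^p} → 𝔽_p. Then in 𝔽_p[X] one has ā^m · b_m(ā^{−1}, X) = − Tr(θ^{τ_p(a)}) · T( θ^{−1−τ_p(a)} · (ā·X + θ)^m ), where b_m(ā^{−1}, X) ∈ 𝔽_p[X] denotes the weighted Bell polynomial b_m(x, λ) reduced modulo p with x specialized to ā^{−1} and λ = X, and θ^{−1−τ_p(a)} denotes the inverse of θ^{1+τ_p(a)} in 𝔽_{p^p}^×. -/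

import Mathlib

open Polynomial

/-- Stirling numbers of the second kind. -/
def stirling2 : ℕ → ℕ → ℕ
  | 0, 0 => 1
  | 0, _ + 1 => 0
  | _ + 1, 0 => 0
  | n + 1, j + 1 => (j + 1) * stirling2 n (j + 1) + stirling2 n j

/-- Evaluation of the weighted Stirling number `R(n,j,λ) = ∑_m C(n,m) S(m,j) λ^{n-m}`. -/
def wStirlingEval {R : Type*} [CommRing R] (n j : ℕ) (lam : R) : R :=
  ∑ m ∈ Finset.range (n + 1), (n.choose m : R) * (stirling2 m j : R) * lam ^ (n - m)

/-- Evaluation of the weighted Bell polynomial `b_n(x,λ) = ∑_j R(n,j,λ) x^j`. -/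
def wBellEval {R : Type*} [CommRing R] (n : ℕ) (x lam : R) : R :=
  ∑ j ∈ Finset.range (n + 1), wStirlingEval n j lam * x ^ j

/-- `τ_p(a) = ∑_{j=1}^{p-1} j p^{ja-1}`. -/
def tauP (p a : ℕ) : ℕ := ∑ j ∈ Finset.Icc 1 (p - 1), j * p ^ (j * a - 1)

theorem stirling2_eq_zero_of_lt {n j : ℕ} (h : n < j) : stirling2 n j = 0 := by
  induction n generalizing j with
  | zero => obtain ⟨j, rfl⟩ := Nat.exists_eq_succ_of_ne_zero h.ne'; rfl
  | succ n ih =>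
    obtain ⟨j, rfl⟩ := Nat.exists_eq_succ_of_ne_zero (Nat.ne_zero_of_lt h)
    rw [stirling2, ih (by lia), ih (by lia), mul_zero]

/-- Expansion of a power in the falling factorials `∏_{i<j} (t - i a)` of step `a`. -/
theorem pow_eq_sum_stirling2_mul_prod {R : Type*} [CommRing R] (t a x : R) (hax : a * x = 1)
    (k : ℕ) :
    t ^ k = ∑ j ∈ Finset.range (k + 1),
      (stirling2 k j : R) * a ^ k * x ^ j * ∏ i ∈ Finset.range j, (t - i * a) := by
  induction k with
  | zero => simp [stirling2]
  | succ k ih =>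
    set P : ℕ → R := fun j => ∏ i ∈ Finset.range j, (t - i * a) with hP
    have hPs (j : ℕ) : t * P j = P (j + 1) + j * a * P j := by
      simp only [hP, Finset.prod_range_succ]; ring
    have hshift : ∑ j ∈ Finset.range (k + 1),
          ((j + 1 : ℕ) : R) * (stirling2 k (j + 1) : R) * a ^ (k + 1) * x ^ (j + 1) * P (j + 1) =
        ∑ j ∈ Finset.range (k + 1),
          (j : R) * (stirling2 k j : R) * a ^ (k + 1) * x ^ j * P j := by
      have h := Finset.sum_range_succ' (fun j : ℕ =>
        (j : R) * (stirling2 k j : R) * a ^ (k + 1) * x ^ j * P j) (k + 1)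
      rw [Finset.sum_range_succ, stirling2_eq_zero_of_lt k.lt_succ_self] at h
      simpa using h.symm
    rw [Finset.sum_range_succ', pow_succ', ih, Finset.mul_sum]
    simp only [stirling2, Nat.cast_zero, zero_mul, add_zero]
    calc ∑ j ∈ Finset.range (k + 1), t * ((stirling2 k j : R) * a ^ k * x ^ j * P j)
        = ∑ j ∈ Finset.range (k + 1),
            ((j : R) * (stirling2 k j : R) * a ^ (k + 1) * x ^ j * P j +
              (stirling2 k j : R) * a ^ (k + 1) * x ^ (j + 1) * P (j + 1)) := by
          refine Finset.sum_congr rfl fun j _ => ?_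
          linear_combination ((stirling2 k j : R) * a ^ k * x ^ j) * hPs j -
            (stirling2 k j : R) * a ^ k * x ^ j * P (j + 1) * hax
      _ = _ := by
          rw [Finset.sum_add_distrib, ← hshift, ← Finset.sum_add_distrib]
          refine Finset.sum_congr rfl fun j _ => ?_
          push_cast
          ring

theorem wBellEval_eq_sum_choose {R : Type*} [CommRing R] (n : ℕ) (x lam : R) :
    wBellEval n x lam = ∑ k ∈ Finset.range (n + 1),
      (n.choose k : R) * (∑ j ∈ Finset.range (k + 1), (stirling2 k j : R) * x ^ j) *
        lam ^ (n - k) := by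
  simp only [wBellEval, wStirlingEval, Finset.sum_mul]
  rw [Finset.sum_comm]
  refine Finset.sum_congr rfl fun k hk => ?_
  rw [Finset.mul_sum, Finset.sum_mul]
  symm
  refine (Finset.sum_subset (Finset.range_subset_range.2 (Finset.mem_range.1 hk))
    fun j _ hj => ?_).trans (Finset.sum_congr rfl fun j _ => by ring)
  rw [stirling2_eq_zero_of_lt (by simpa using hj)]
  simp

theorem prod_mul_prod_succ_pow {M : Type*} [CommMonoid M] (g : ℕ → M) (N : ℕ) :
    (∏ j ∈ Finset.range N, g (j + 1) ^ j) * ∏ j ∈ Finset.range N, g (j + 1) =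
      (∏ j ∈ Finset.range N, g j ^ j) * g N ^ N := by
  rw [← Finset.prod_range_succ, Finset.prod_range_succ', ← Finset.prod_mul_distrib]
  simp [pow_succ]

section ZModReindexing

variable {p : ℕ} [Fact p.Prime] {M : Type*} [CommMonoid M] {a : ℕ}

@[to_additive]
theorem prod_range_zmod_affine (ha : (a : ZMod p) ≠ 0) (b : ZMod p) (g : ZMod p → M) :
    ∏ i ∈ Finset.range p, g (i * a + b) = ∏ u, g u := by
  have hval : ∏ i ∈ Finset.range p, g (i * a + b) = ∏ u : ZMod p, g (u * a + b) := by
    refine Finset.prod_bij (fun i _ => (i : ZMod p)) (by simp) (fun i hi j hj h => ?_)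
      (fun u _ => ⟨u.val, by simpa using u.val_lt, by simp⟩) (by simp)
    rw [ZMod.natCast_eq_natCast_iff'] at h
    rwa [Nat.mod_eq_of_lt (by simpa using hi), Nat.mod_eq_of_lt (by simpa using hj)] at h
  rw [hval]
  exact Equiv.prod_comp ((Equiv.mulRight₀ (a : ZMod p) ha).trans (Equiv.addRight b)) g

end ZModReindexing

theorem prod_add_zmod {p : ℕ} [Fact p.Prime] {R : Type*} [CommRing R] [Algebra (ZMod p) R]
    (t : R) : ∏ u : ZMod p, (t + algebraMap (ZMod p) R u) = t ^ p - t := by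
  have hroots : (X ^ p - X : (ZMod p)[X]).roots = Finset.univ.val := by
    simpa using FiniteField.roots_X_pow_card_sub_X (ZMod p)
  have hmonic : (X ^ p - X : (ZMod p)[X]).Monic :=
    monic_X_pow_sub (by simpa using (Fact.out : p.Prime).one_lt)
  have hprod : ∏ u : ZMod p, (X - C u) = (X ^ p - X : (ZMod p)[X]) := by
    have h := (GaloisField.splits_zmod_X_pow_sub_X p).eq_prod_roots
    rw [hroots, hmonic.leadingCoeff] at h
    simpa using h.symm
  have h := congrArg (aeval t) hprod
  simp only [map_prod, map_sub, map_pow, aeval_X, aeval_C] at h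
  rw [← h, ← Equiv.prod_comp (Equiv.neg (ZMod p))]
  simp [sub_eq_add_neg]

section ArtinSchreier

variable {p : ℕ} [Fact p.Prime] {F : Type*} [Field F] [Algebra (ZMod p) F] {θ : F}

theorem artinSchreier_add_pow_pow (hθ : θ ^ p = θ + 1) (u : ZMod p) (n : ℕ) :
    (θ + algebraMap (ZMod p) F u) ^ p ^ n = θ + algebraMap (ZMod p) F (u + n) := by
  have : CharP F p := charP_of_injective_algebraMap (algebraMap (ZMod p) F).injective p
  induction n with
  | zero => simp
  | succ n ih =>
    rw [pow_succ, pow_mul, ih, add_pow_char, hθ, ← map_pow, ZMod.pow_card]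
    simp only [map_add, map_natCast]
    push_cast
    ring

theorem artinSchreier_pow_pow (hθ : θ ^ p = θ + 1) (n : ℕ) : θ ^ p ^ n = θ + n := by
  simpa using artinSchreier_add_pow_pow hθ 0 n

theorem artinSchreier_prod_add (hθ : θ ^ p = θ + 1) {a : ℕ} (ha : (a : ZMod p) ≠ 0)
    (b : ZMod p) : ∏ i ∈ Finset.range p, (θ + algebraMap (ZMod p) F (i * a + b)) = 1 := by
  rw [prod_range_zmod_affine ha b fun v => θ + algebraMap (ZMod p) F v, prod_add_zmod, hθ,
    add_sub_cancel_left]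

theorem artinSchreier_pow_tauP (hθ : θ ^ p = θ + 1) {a : ℕ} (ha : (a : ZMod p) ≠ 0) :
    (θ ^ tauP p a) ^ p ^ a = θ ^ (1 + tauP p a) := by
  have hp : p.Prime := Fact.out
  have ha0 : 0 < a := Nat.pos_of_ne_zero (by rintro rfl; simp at ha)
  set g : ℕ → F := fun j => θ + algebraMap (ZMod p) F (j * a - 1) with hg
  have htau : θ ^ tauP p a = ∏ j ∈ Finset.range p, g j ^ j := by
    have hI : Finset.Icc 1 (p - 1) = Finset.Ico (0 + 1) p := by
      ext j
      simp only [Finset.mem_Icc, Finset.mem_Ico]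
      have := hp.pos
      lia
    rw [Finset.range_eq_Ico, Finset.prod_eq_prod_Ico_succ_bot hp.pos, pow_zero, one_mul, tauP,
      ← Finset.prod_pow_eq_pow_sum, hI]
    refine Finset.prod_congr rfl fun j hj => ?_
    have hj1 : 1 ≤ j * a := Nat.mul_pos (Finset.mem_Ico.1 hj).1 ha0
    rw [mul_comm, pow_mul, artinSchreier_pow_pow hθ, Nat.cast_sub hj1]
    simp [hg]
  have hshift (j : ℕ) : g j ^ p ^ a = g (j + 1) := by
    simp only [hg, artinSchreier_add_pow_pow hθ]
    congr 2
    push_cast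
    ring
  have hone : ∏ j ∈ Finset.range p, g (j + 1) = 1 := by
    rw [← artinSchreier_prod_add (F := F) hθ ha (a - 1)]
    refine Finset.prod_congr rfl fun j _ => ?_
    simp only [hg]
    congr 2
    push_cast
    ring
  have hlast : g p ^ p = θ := by
    have hgp : g p = θ + algebraMap (ZMod p) F (-1) := by
      rw [hg]
      beta_reduce
      rw [CharP.cast_eq_zero, zero_mul, zero_sub]
    simpa [hgp] using artinSchreier_add_pow_pow hθ (-1) 1
  have h := prod_mul_prod_succ_pow g p
  rw [hone, mul_one, hlast, ← htau] at h
  rw [pow_add, pow_one, mul_comm, ← h, htau, ← Finset.prod_pow]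
  refine Finset.prod_congr rfl fun j _ => ?_
  rw [← pow_mul, mul_comm, pow_mul, hshift]

theorem artinSchreier_pow_one_add_tauP_pow (hθ : θ ^ p = θ + 1) {a : ℕ} (ha : (a : ZMod p) ≠ 0)
    (i : ℕ) :
    (θ ^ (1 + tauP p a)) ^ p ^ (i * a) =
      θ ^ (1 + tauP p a) * ∏ j ∈ Finset.range i, (θ + ((j + 1 : ℕ) * a : F)) := by
  have hstep : (θ ^ (1 + tauP p a)) ^ p ^ a = θ ^ (1 + tauP p a) * (θ + a) := by
    rw [pow_add θ, mul_pow, artinSchreier_pow_tauP hθ ha, pow_one, artinSchreier_pow_pow hθ,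
      pow_add, pow_one]
    ring
  induction i with
  | zero => simp
  | succ i ih =>
    have hi := artinSchreier_add_pow_pow (F := F) hθ a (i * a)
    rw [map_natCast] at hi
    rw [Nat.succ_mul, add_comm (i * a), pow_add p, pow_mul, hstep, mul_pow, ih, hi,
      Finset.prod_range_succ, mul_assoc]
    congr 3
    simp only [map_add, map_natCast]
    push_cast
    ring

end ArtinSchreier

section FiniteFieldTrace

variable {p : ℕ} [Fact p.Prime] {F : Type*} [Field F] [Finite F] [Algebra (ZMod p) F]

theorem trace_pow_char_pow (y : F) (n : ℕ) :
    Algebra.trace (ZMod p) F (y ^ p ^ n) = Algebra.trace (ZMod p) F y := by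
  have h := Algebra.trace_eq_of_algEquiv
    (FiniteField.frobeniusAlgEquivOfAlgebraic (ZMod p) F ^ n) y
  rwa [AlgEquiv.coe_pow, FiniteField.coe_frobeniusAlgEquivOfAlgebraic_iterate, ZMod.card] at h

theorem finrank_zmod_eq {n : ℕ} (hcard : Nat.card F = p ^ n) : Module.finrank (ZMod p) F = n := by
  have h := Module.natCard_eq_pow_finrank (K := ZMod p) (V := F)
  rw [hcard, Nat.card_zmod] at h
  exact (Nat.pow_right_injective (Fact.out : p.Prime).two_le h).symm

theorem algebraMap_trace_eq_sum_pow_mul (hcard : Nat.card F = p ^ p) {a : ℕ}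
    (ha : (a : ZMod p) ≠ 0) (y : F) :
    algebraMap (ZMod p) F (Algebra.trace (ZMod p) F y) =
      ∑ i ∈ Finset.range p, y ^ p ^ (i * a) := by
  have hper (n : ℕ) : y ^ p ^ n = y ^ p ^ (n : ZMod p).val := by
    have := Fintype.ofFinite F
    rw [ZMod.val_natCast]
    conv_lhs => rw [← Nat.mod_add_div n p, pow_add, pow_mul p p, ← hcard, pow_mul]
    rw [Nat.card_eq_fintype_card, FiniteField.pow_card_pow]
  rw [FiniteField.algebraMap_trace_eq_sum_pow, finrank_zmod_eq hcard, Nat.card_zmod]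
  have h (b : ℕ) (hb : (b : ZMod p) ≠ 0) : ∑ i ∈ Finset.range p, y ^ p ^ (i * b) =
      ∑ u : ZMod p, y ^ p ^ u.val := by
    simpa [hper (_ * _)] using sum_range_zmod_affine hb 0 fun u => y ^ p ^ u.val
  rw [h a ha, ← h 1 (by simp)]
  simp

theorem trace_artinSchreier_pow (hcard : Nat.card F = p ^ p) {θ : F}
    (hθ : θ ^ p = θ + 1) : Algebra.trace (ZMod p) F (θ ^ (p - 1)) = -1 := by
  have hp : p.Prime := Fact.out
  apply (algebraMap (ZMod p) F).injective
  have hlow (l : ℕ) (hl : l < p - 1) : ∑ u : ZMod p, u ^ l = 0 :=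
    FiniteField.sum_pow_lt_card_sub_one _ l (by simpa using hl)
  have htop : ∑ u : ZMod p, u ^ (p - 1) = -1 := by
    have h (u : ZMod p) : u ^ (p - 1) = 1 - if u = 0 then 1 else 0 := by
      split_ifs with hu
      · simp [hu, (Nat.sub_pos_of_lt hp.one_lt).ne']
      · simp [ZMod.pow_card_sub_one_eq_one hu]
    simp [h]
  rw [algebraMap_trace_eq_sum_pow_mul hcard (a := 1) (by simp)]
  calc ∑ i ∈ Finset.range p, (θ ^ (p - 1)) ^ p ^ (i * 1)
      = ∑ u : ZMod p, (θ + algebraMap (ZMod p) F u) ^ (p - 1) := by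
        rw [← sum_range_zmod_affine (p := p) (a := 1) (by simp) 0]
        refine Finset.sum_congr rfl fun i _ => ?_
        rw [← pow_mul, mul_comm, pow_mul, artinSchreier_pow_pow hθ]
        simp
    _ = ∑ l ∈ Finset.range (p - 1 + 1), θ ^ (p - 1 - l) * ((p - 1).choose l : F) *
          algebraMap (ZMod p) F (∑ u : ZMod p, u ^ l) := by
        simp only [add_comm θ, add_pow, map_sum, Finset.mul_sum]
        rw [Finset.sum_comm]
        refine Finset.sum_congr rfl fun l _ => Finset.sum_congr rfl fun u _ => ?_
        rw [map_pow]
        ring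
    _ = algebraMap (ZMod p) F (-1) := by
        rw [Finset.sum_range_succ, htop, Finset.sum_eq_zero fun l hl => ?_]
        · simp
        · rw [hlow l (Finset.mem_range.1 hl), map_zero, mul_zero]

/-- Traces of rising factorials of step `a` without the factor `θ`. -/
theorem trace_prod_add_mul (hcard : Nat.card F = p ^ p) {θ : F} (hθ : θ ^ p = θ + 1) {a : ℕ}
    (ha : (a : ZMod p) ≠ 0) {i : ℕ} (hi : i < p) :
    Algebra.trace (ZMod p) F (∏ j ∈ Finset.range i, (θ + ((j + 1 : ℕ) * a : F))) =
      if i = p - 1 then -1 else 0 := by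
  have hp : p.Prime := Fact.out
  split_ifs with h
  · have hθ0 : θ ≠ 0 := by
      rintro rfl
      simp [hp.ne_zero] at hθ
    have hprod := artinSchreier_prod_add (F := F) hθ ha 0
    obtain ⟨q, rfl⟩ : ∃ q, p = q + 1 := ⟨p - 1, by have := hp.pos; lia⟩
    rw [Finset.prod_range_succ'] at hprod
    obtain rfl : i = q := by simpa using h
    have hinv : ∏ j ∈ Finset.range i, (θ + ((j + 1 : ℕ) * a : F)) = θ ^ i - 1 := by
      apply mul_right_cancel₀ hθ0
      rw [sub_mul, ← pow_succ, hθ, one_mul, add_sub_cancel_left]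
      simpa using hprod
    have htop := trace_artinSchreier_pow hcard hθ
    rw [Nat.add_sub_cancel] at htop
    rw [hinv, map_sub, htop, ← map_one (algebraMap (ZMod (i + 1)) F), Algebra.trace_algebraMap,
      finrank_zmod_eq hcard, nsmul_eq_mul, CharP.cast_eq_zero, zero_mul, sub_zero]
  · set y : F := ∏ j ∈ Finset.range (i + 1), (θ + (j * a : F)) with hy
    have hfrob : y ^ p ^ a = ∏ j ∈ Finset.range (i + 1), (θ + ((j + 1 : ℕ) * a : F)) := by
      rw [hy, ← Finset.prod_pow]
      refine Finset.prod_congr rfl fun j _ => ?_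
      have := artinSchreier_add_pow_pow (F := F) hθ (j * a) a
      simp only [map_mul, map_add, map_natCast] at this
      rw [this]
      push_cast
      ring
    have hdiff : y ^ p ^ a - y =
        (((i + 1 : ℕ) : ZMod p) * a) •
          ∏ j ∈ Finset.range i, (θ + ((j + 1 : ℕ) * a : F)) := by
      rw [hfrob, hy, Finset.prod_range_succ, Finset.prod_range_succ', Algebra.smul_def]
      simp only [map_mul, map_natCast]
      push_cast
      ring
    have h0 := congrArg (Algebra.trace (ZMod p) F) hdiff
    rw [map_sub, trace_pow_char_pow, sub_self, map_smul, smul_eq_mul] at h0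
    refine (mul_eq_zero.1 h0.symm).resolve_left (mul_ne_zero ?_ ha)
    rw [Ne, ZMod.natCast_eq_zero_iff]
    exact Nat.not_dvd_of_pos_of_lt i.succ_pos (by lia)

/-- The trace form against `-Tr(θ^τ) θ^{-1-τ}` takes the value `1` on every falling factorial of
step `a`. -/
theorem neg_trace_mul_trace_inv_mul_prod (hcard : Nat.card F = p ^ p) {θ : F}
    (hθ : θ ^ p = θ + 1) {a : ℕ} (ha : (a : ZMod p) ≠ 0) (k : ℕ) :
    -Algebra.trace (ZMod p) F (θ ^ tauP p a) *
      Algebra.trace (ZMod p) F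
        ((θ ^ (1 + tauP p a))⁻¹ * ∏ i ∈ Finset.range k, (θ - (i * a : F))) = 1 := by
  have hp : p.Prime := Fact.out
  have hθ0 : θ ≠ 0 := by
    rintro rfl
    simp [hp.ne_zero] at hθ
  set w := θ ^ (1 + tauP p a) with hw
  have hw0 : w ≠ 0 := pow_ne_zero _ hθ0
  have hpow := artinSchreier_pow_one_add_tauP_pow hθ ha
  rw [← hw] at hpow
  have hwa : w ^ p ^ a = w * (θ + a) := by simpa using hpow 1
  have hθa : θ + a ≠ 0 := by
    intro h
    rw [h, mul_zero] at hwa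
    exact pow_ne_zero _ hw0 hwa
  induction k with
  | zero =>
    have htr : Algebra.trace (ZMod p) F (θ ^ tauP p a) = Algebra.trace (ZMod p) F w := by
      rw [hw, ← artinSchreier_pow_tauP hθ ha, trace_pow_char_pow]
    have hc : algebraMap (ZMod p) F (Algebra.trace (ZMod p) F w) * w⁻¹ =
        ∑ i ∈ Finset.range p, ∏ j ∈ Finset.range i, (θ + ((j + 1 : ℕ) * a : F)) := by
      rw [algebraMap_trace_eq_sum_pow_mul hcard ha, Finset.sum_congr rfl fun i _ => hpow i,
        ← Finset.mul_sum, mul_comm w, mul_inv_cancel_right₀ hw0]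
    have hsum : Algebra.trace (ZMod p) F
        (∑ i ∈ Finset.range p, ∏ j ∈ Finset.range i, (θ + ((j + 1 : ℕ) * a : F))) = -1 := by
      rw [map_sum, Finset.sum_congr rfl fun i hi =>
        trace_prod_add_mul hcard hθ ha (Finset.mem_range.1 hi)]
      simp [hp.pos]
    rw [Finset.prod_range_zero, mul_one, htr, neg_mul, ← smul_eq_mul, ← map_smul,
      Algebra.smul_def, hc, hsum, neg_neg]
  | succ k ih =>
    rw [← ih, ← trace_pow_char_pow (w⁻¹ * _) a]
    congr 2
    have hprod : (∏ i ∈ Finset.range k, (θ - ((i + 1 : ℕ) * a : F))) ^ p ^ a =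
        ∏ i ∈ Finset.range k, (θ - (i * a : F)) := by
      rw [← Finset.prod_pow]
      refine Finset.prod_congr rfl fun i _ => ?_
      have h := artinSchreier_add_pow_pow (F := F) hθ (-((i + 1 : ℕ) * a)) a
      simp only [map_neg, map_mul, map_add, map_natCast] at h
      rw [sub_eq_add_neg, h]
      push_cast
      ring
    rw [Finset.prod_range_succ', mul_pow, mul_pow, hprod, inv_pow, hwa, Nat.cast_zero, zero_mul,
      sub_zero, artinSchreier_pow_pow hθ]
    field_simp

theorem neg_trace_mul_trace_inv_mul_pow (hcard : Nat.card F = p ^ p) {θ : F}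
    (hθ : θ ^ p = θ + 1) {a : ℕ} (ha : (a : ZMod p) ≠ 0) (k : ℕ) :
    -Algebra.trace (ZMod p) F (θ ^ tauP p a) *
      Algebra.trace (ZMod p) F ((θ ^ (1 + tauP p a))⁻¹ * θ ^ k) =
    (a : ZMod p) ^ k *
      ∑ j ∈ Finset.range (k + 1), (stirling2 k j : ZMod p) * (a : ZMod p)⁻¹ ^ j := by
  have hax : (a : F) * algebraMap (ZMod p) F (a : ZMod p)⁻¹ = 1 := by
    rw [← map_natCast (algebraMap (ZMod p) F), ← map_mul, mul_inv_cancel₀ ha, map_one]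
  rw [pow_eq_sum_stirling2_mul_prod θ _ _ hax k, Finset.mul_sum, map_sum, Finset.mul_sum,
    Finset.mul_sum]
  refine Finset.sum_congr rfl fun j _ => ?_
  have hscalar : (θ ^ (1 + tauP p a))⁻¹ * ((stirling2 k j : F) * (a : F) ^ k *
        algebraMap (ZMod p) F (a : ZMod p)⁻¹ ^ j * ∏ i ∈ Finset.range j, (θ - (i * a : F))) =
      ((stirling2 k j : ZMod p) * (a : ZMod p) ^ k * (a : ZMod p)⁻¹ ^ j) •
        ((θ ^ (1 + tauP p a))⁻¹ * ∏ i ∈ Finset.range j, (θ - (i * a : F))) := by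
    rw [Algebra.smul_def]
    simp only [map_mul, map_pow, map_natCast]
    ring
  rw [hscalar, map_smul, smul_eq_mul, mul_left_comm,
    neg_trace_mul_trace_inv_mul_prod hcard hθ ha j]
  ring

end FiniteFieldTrace

/-- Trace formula for weighted Bell polynomials:
`a^m b_m(a⁻¹, X) = - Tr(θ^{τ_p(a)}) · T(θ^{-1-τ_p(a)} (aX + θ)^m)` in `𝔽_p[X]`,
where `T` is the coefficientwise extension of the trace. -/
theorem weighted_bell_trace_formula
    (p : ℕ) [Fact p.Prime]
    (F : Type*) [Field F] [Fintype F] [Algebra (ZMod p) F]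
    (hcard : Fintype.card F = p ^ p)
    (θ : F) (hθ : θ ^ p = θ + 1)
    (a m : ℕ) (ha : 1 ≤ a) (hap : Nat.gcd a p = 1)
    (T : Polynomial F → Polynomial (ZMod p))
    (hT : ∀ q : Polynomial F,
      T q = q.sum fun n c => Polynomial.C (Algebra.trace (ZMod p) F c) * Polynomial.X ^ n) :
    Polynomial.C ((a : ZMod p) ^ m) *
        wBellEval m (Polynomial.C ((a : ZMod p)⁻¹)) (Polynomial.X : Polynomial (ZMod p)) =
      - Polynomial.C (Algebra.trace (ZMod p) F (θ ^ tauP p a)) *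
        T (Polynomial.C ((θ ^ (1 + tauP p a))⁻¹) *
          (Polynomial.C (algebraMap (ZMod p) F (a : ZMod p)) * Polynomial.X +
            Polynomial.C θ) ^ m) := by
  have ha0 : (a : ZMod p) ≠ 0 := by
    rw [Ne, ZMod.natCast_eq_zero_iff]
    intro h
    exact (Fact.out : p.Prime).one_lt.ne' (Nat.dvd_one.1 (hap ▸ Nat.dvd_gcd h dvd_rfl))
  have hcoeff (q : F[X]) (n : ℕ) : (T q).coeff n = Algebra.trace (ZMod p) F (q.coeff n) := by
    rw [hT, Polynomial.sum_def, finsetSum_coeff]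
    simp only [coeff_C_mul_X_pow]
    rw [Finset.sum_ite_eq, ite_eq_left_iff]
    intro h
    rw [notMem_support_iff.1 h, map_zero]
  have hTsum (s : Finset ℕ) (f : ℕ → F[X]) : T (∑ i ∈ s, f i) = ∑ i ∈ s, T (f i) := by
    ext n
    simp [hcoeff]
  have hTmono (c : F) (n : ℕ) :
      T (C c * X ^ n) = C (Algebra.trace (ZMod p) F c) * X ^ n := by
    ext i
    rw [hcoeff, coeff_C_mul_X_pow, coeff_C_mul_X_pow, apply_ite (Algebra.trace (ZMod p) F),
      map_zero]
  have hcard' : Nat.card F = p ^ p := by rw [Nat.card_eq_fintype_card, hcard]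
  rw [wBellEval_eq_sum_choose, add_comm (_ * X), add_pow, Finset.mul_sum, Finset.mul_sum, hTsum,
    Finset.mul_sum]
  refine Finset.sum_congr rfl fun k hk => ?_
  have hterm : C ((θ ^ (1 + tauP p a))⁻¹) * (C θ ^ k *
      (C (algebraMap (ZMod p) F (a : ZMod p)) * X) ^ (m - k) * (m.choose k : F[X])) =
      C (((a : ZMod p) ^ (m - k) * (m.choose k : ZMod p)) • ((θ ^ (1 + tauP p a))⁻¹ * θ ^ k)) *
        X ^ (m - k) := by
    rw [Algebra.smul_def, mul_pow]
    simp only [map_mul, map_pow, map_natCast]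
    ring
  have hm : (a : ZMod p) ^ m = (a : ZMod p) ^ (m - k) * (a : ZMod p) ^ k := by
    rw [← pow_add, Nat.sub_add_cancel (Nat.lt_succ_iff.1 (Finset.mem_range.1 hk))]
  have hmoment := congrArg (C : ZMod p → (ZMod p)[X])
    (neg_trace_mul_trace_inv_mul_pow hcard' hθ ha0 k)
  rw [hterm, hTmono, map_smul, smul_eq_mul, hm]
  simp only [map_mul, map_neg, map_pow, map_sum, map_natCast] at hmoment ⊢
  linear_combination (-(a : (ZMod p)[X]) ^ (m - k) * (m.choose k : (ZMod p)[X]) * X ^ (m - k)) *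
    hmoment
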